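/- Let p be a prime, q a power of p, and let f be a homogeneous polynomial of degree d over the finite field 𝔽_q in n+1 variables, with 1 ≤ d ≤ n. Then the number of zeros of f in 𝔽_q^{n+1} (the affine cone over the projective hypersurface f = 0) is divisible by q. -/

import Mathlib

open Finset MvPolynomial

theorem Nat.sum_digits_add_mul {p : ℕ} (hp : 1 < p) {c : ℕ} (hc : c < p) (k : ℕ) :
    (p.digits (c + p * k)).sum = c + (p.digits k).sum := by
  by_cases h : c ≠ 0 ∨ k ≠ 0
  · rw [Nat.digits_add p hp c k hc h, List.sum_cons]
  · push Not at h
    simp [h.1, h.2]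

theorem Nat.sum_digits_pow_mul {p : ℕ} (hp : 1 < p) (m k : ℕ) :
    (p.digits (p ^ m * k)).sum = (p.digits k).sum := by
  induction m with
  | zero => simp
  | succ m ih =>
    have := Nat.sum_digits_add_mul hp (c := 0) (by omega) (p ^ m * k)
    rw [pow_succ', mul_assoc, ← ih]
    simpa using this

theorem Nat.sum_digits_pow_sub_one {p : ℕ} (hp : 1 < p) (m : ℕ) :
    (p.digits (p ^ m - 1)).sum = m * (p - 1) := by
  induction m with
  | zero => simp
  | succ m ih =>
    have h : p ^ (m + 1) - 1 = (p - 1) + p * (p ^ m - 1) := by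
      obtain ⟨u, hu⟩ := Nat.exists_eq_succ_of_ne_zero (pow_ne_zero m (by omega : p ≠ 0))
      rw [pow_succ', hu, Nat.succ_sub_one, Nat.mul_succ]
      omega
    rw [h, Nat.sum_digits_add_mul hp (by omega), ih]
    ring

/-- The numbers obtained from `k` by cyclically shifting its base `p` digits, their positions
being read modulo `m`. -/
theorem Nat.exists_cyclic_digit_shifts {p : ℕ} (hp : 1 < p) (m k : ℕ) :
    ∃ g : ℕ → ℕ, (∀ t, g t ≡ p ^ t * k [MOD p ^ m - 1]) ∧ (0 < k → ∀ t, 0 < g t) ∧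
      (∀ t, g (t + m) = g t) ∧
      (∑ t ∈ range m, g t) * (p - 1) = (p.digits k).sum * (p ^ m - 1) := by
  induction k using Nat.strong_induction_on with
  | _ k ih =>
    rcases Nat.eq_zero_or_pos k with rfl | hk
    · exact ⟨fun _ => 0, by simp [Nat.ModEq.refl], by simp, by simp, by simp⟩
    obtain ⟨g, hmod, hpos, hper, hsum⟩ := ih (k / p) (Nat.div_lt_self hk hp)
    have hkp : k % p + p * (k / p) = k := Nat.mod_add_div k p
    have hp0 : 0 < p := by omega
    refine ⟨fun t => k % p * p ^ (t % m) + g (t + 1), fun t => ?_, fun _ t => ?_, fun t => ?_, ?_⟩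
    · have h1 : p ^ m ≡ 1 [MOD p ^ m - 1] := by
        refine ((Nat.modEq_iff_dvd' ?_).2 dvd_rfl).symm
        exact Nat.pow_pos hp0
      have h2 : p ^ (t % m) ≡ p ^ t [MOD p ^ m - 1] := by
        conv_rhs => rw [← Nat.mod_add_div t m, pow_add, pow_mul]
        simpa using ((h1.pow (t / m)).mul_left (p ^ (t % m))).symm
      have h3 := (h2.mul_left (k % p)).add (hmod (t + 1))
      have h4 : p ^ t * k = k % p * p ^ t + p ^ (t + 1) * (k / p) := by
        conv_lhs => rw [← hkp]
        ring
      rw [h4]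
      exact h3
    · rcases Nat.eq_zero_or_pos (k / p) with h | h
      · have : 0 < k % p := by
          rw [h] at hkp
          omega
        have := Nat.mul_pos this (Nat.pow_pos (n := t % m) hp0)
        dsimp only
        omega
      · exact Nat.add_pos_right _ (hpos h _)
    · simp only [Nat.add_mod_right]
      rw [show t + m + 1 = t + 1 + m by ring, hper]
    · have h1 : ∑ t ∈ range m, g (t + 1) = ∑ t ∈ range m, g t := by
        have := sum_range_succ' g m
        rw [sum_range_succ] at this
        have h0 := hper 0
        rw [zero_add] at h0
        omega
      have h2 : ∑ t ∈ range m, k % p * p ^ (t % m) = k % p * ∑ t ∈ range m, p ^ t := by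
        rw [mul_sum]
        refine sum_congr rfl fun t ht => ?_
        rw [Nat.mod_eq_of_lt (mem_range.1 ht)]
      have h3 : (∑ t ∈ range m, p ^ t) * (p - 1) = p ^ m - 1 := by
        have := Nat.geomSum_eq (m := p) hp m
        rw [this]
        exact Nat.div_mul_cancel (by simpa using Nat.sub_dvd_pow_sub_pow p 1 m)
      have h4 : (p.digits k).sum = k % p + (p.digits (k / p)).sum := by
        conv_lhs => rw [← hkp]
        exact Nat.sum_digits_add_mul hp (Nat.mod_lt _ hp0) _
      rw [sum_add_distrib, h1, h2, add_mul, hsum, h4, mul_assoc, h3, add_mul]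

theorem Nat.two_mul_le_sum_sum_digits {ι σ : Type*} [Fintype σ] {p m D : ℕ} (hp : 1 < p)
    (hm : 0 < m) (s : Finset ι) (a : ι → σ → ℕ) (ha : ∀ i ∈ s, ∑ j, a i j ≤ D)
    (hD : D < Fintype.card σ) (k : ι → ℕ) (hk : p ^ m - 1 ∣ ∑ i ∈ s, k i)
    (hdvd : ∀ j, p ^ m - 1 ∣ ∑ i ∈ s, k i * a i j) (hpos : ∀ j, 0 < ∑ i ∈ s, k i * a i j) :
    2 * (m * (p - 1)) ≤ ∑ i ∈ s, (p.digits (k i)).sum := by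
  choose g hmod hgpos _ hsum using fun i => Nat.exists_cyclic_digit_shifts hp m (k i)
  have hq : 0 < p ^ m - 1 := Nat.sub_pos_of_lt (Nat.one_lt_pow hm.ne' hp)
  have key (t : ℕ) : 2 * (p ^ m - 1) ≤ ∑ i ∈ s, g i t := by
    have hG : p ^ m - 1 ∣ ∑ i ∈ s, g i t := by
      refine ((Nat.ModEq.sum fun i _ => hmod i t).dvd_iff dvd_rfl).2 ?_
      rw [← mul_sum]
      exact hk.mul_left _
    have he (j : σ) : p ^ m - 1 ≤ ∑ i ∈ s, g i t * a i j := by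
      refine Nat.le_of_dvd ?_ ?_
      · obtain ⟨i, hi, h⟩ := (sum_pos_iff (M := ℕ)).1 (hpos j)
        exact sum_pos_iff.2 ⟨i, hi, Nat.mul_pos (hgpos i (Nat.pos_of_mul_pos_right h) t)
          (Nat.pos_of_mul_pos_left h)⟩
      · refine ((Nat.ModEq.sum fun i _ => (hmod i t).mul_right (a i j)).dvd_iff dvd_rfl).2 ?_
        simp only [mul_assoc]
        rw [← mul_sum]
        exact (hdvd j).mul_left _
    have hle : Fintype.card σ * (p ^ m - 1) ≤ (∑ i ∈ s, g i t) * D := calc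
      _ = ∑ _j : σ, (p ^ m - 1) := by simp
      _ ≤ ∑ j, ∑ i ∈ s, g i t * a i j := sum_le_sum fun j _ => he j
      _ = ∑ i ∈ s, g i t * ∑ j, a i j := by
        rw [sum_comm]
        simp only [mul_sum]
      _ ≤ ∑ i ∈ s, g i t * D := sum_le_sum fun i hi => Nat.mul_le_mul_left _ (ha i hi)
      _ = _ := (sum_mul ..).symm
    obtain ⟨c, hc⟩ := hG
    have hc2 : 2 ≤ c := by
      by_contra! h
      rw [hc] at hle
      have : (p ^ m - 1) * c * D ≤ (p ^ m - 1) * 1 * D := by gcongr; omega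
      nlinarith
    rw [hc, mul_comm]
    exact Nat.mul_le_mul_left _ hc2
  refine Nat.le_of_mul_le_mul_right ?_ hq
  calc 2 * (m * (p - 1)) * (p ^ m - 1) = (∑ _t ∈ range m, 2 * (p ^ m - 1)) * (p - 1) := by
        rw [sum_const, card_range, smul_eq_mul]
        ring
    _ ≤ (∑ t ∈ range m, ∑ i ∈ s, g i t) * (p - 1) :=
        Nat.mul_le_mul_right _ (sum_le_sum fun t _ => key t)
    _ = _ := by
        rw [sum_comm, sum_mul, sum_mul]
        exact sum_congr rfl fun i _ => hsum i

theorem Nat.sub_one_mul_padicValNat_multinomial {ι : Type*} (p : ℕ) [hp : Fact p.Prime]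
    (s : Finset ι) (k : ι → ℕ) :
    (p - 1) * padicValNat p (Nat.multinomial s k) + (p.digits (∑ i ∈ s, k i)).sum =
      ∑ i ∈ s, (p.digits (k i)).sum := by
  have hfac (n : ℕ) : (p - 1) * padicValNat p n.factorial + (p.digits n).sum = n := by
    rw [sub_one_mul_padicValNat_factorial]
    exact Nat.sub_add_cancel (Nat.digit_sum_le p n)
  have hprod : padicValNat p (∏ i ∈ s, (k i).factorial) =
      ∑ i ∈ s, padicValNat p (k i).factorial := by
    classical
    induction s using Finset.induction_on with
    | empty => simp
    | insert i s hi ih =>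
      rw [prod_insert hi, sum_insert hi, padicValNat.mul (Nat.factorial_ne_zero _)
        (prod_ne_zero_iff.2 fun _ _ => Nat.factorial_ne_zero _), ih]
  have hmul : padicValNat p (∏ i ∈ s, (k i).factorial) + padicValNat p (Nat.multinomial s k) =
      padicValNat p (∑ i ∈ s, k i).factorial := by
    rw [← padicValNat.mul (prod_ne_zero_iff.2 fun _ _ => Nat.factorial_ne_zero _)
      (Nat.multinomial_pos s k).ne', Nat.multinomial_spec]
  have h1 := hfac (∑ i ∈ s, k i)
  have h2 : ∑ i ∈ s, ((p - 1) * padicValNat p (k i).factorial + (p.digits (k i)).sum) =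
      ∑ i ∈ s, k i := sum_congr rfl fun i _ => hfac (k i)
  rw [sum_add_distrib, ← mul_sum, ← hprod] at h2
  rw [← hmul, mul_add] at h1
  omega

namespace WittVector

variable {p : ℕ} [hp : Fact p.Prime] {K : Type*} [Field K] [CharP K p]

theorem natCast_pow_dvd_natCast {m N : ℕ} (h : (p : WittVector p K) ^ m ∣ N) : p ^ m ∣ N := by
  induction m generalizing N with
  | zero => simp
  | succ m ih =>
    have hpN : p ∣ N := by
      have h' := map_dvd (constantCoeff (p := p) (R := K)) ((dvd_pow_self _ m.succ_ne_zero).trans h)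
      rw [map_natCast, map_natCast, CharP.cast_eq_zero, zero_dvd_iff] at h'
      exact (CharP.cast_eq_zero_iff K p N).1 h'
    obtain ⟨N, rfl⟩ := hpN
    rw [pow_succ', Nat.cast_mul] at h
    rw [pow_succ']
    exact mul_dvd_mul_left p (ih ((mul_dvd_mul_iff_left (p_nonzero p K)).1 h))

theorem natCast_dvd_iff_constantCoeff [PerfectRing K p] (x : WittVector p K) :
    (p : WittVector p K) ∣ x ↔ constantCoeff x = 0 := by
  rw [← Ideal.mem_span_singleton, ← ker_constantCoeff, RingHom.mem_ker]

variable [Fintype K]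

theorem sum_teichmuller_pow_eq_zero {e : ℕ} (he : ¬ Fintype.card K - 1 ∣ e) :
    ∑ x : K, teichmuller p x ^ e = 0 := by
  rw [← FiniteField.forall_pow_eq_one_iff] at he
  push Not at he
  obtain ⟨u, hu⟩ := he
  have hne : teichmuller p (u : K) ^ e ≠ 1 := fun h => hu <| by
    have := congrArg (fun y : WittVector p K => y.coeff 0) h
    rw [← map_pow] at this
    simp only [teichmuller_coeff_zero, one_coeff_zero] at this
    exact Units.ext (by rwa [Units.val_pow_eq_pow_val])
  have hinv : teichmuller p (u : K) ^ e * ∑ x : K, teichmuller p x ^ e =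
      ∑ x : K, teichmuller p x ^ e := by
    rw [mul_sum]
    refine Fintype.sum_equiv u.mulLeft _ _ fun x => ?_
    simp [mul_pow]
  by_contra h
  exact hne (mul_right_cancel₀ h (by rw [hinv, one_mul]))

variable {σ : Type*} [Fintype σ] [DecidableEq σ]

/-- Ax's expansion of the power sums of a Teichmüller lift. -/
theorem pow_dvd_sum_lift_pow {m : ℕ} (hm : 0 < m) (hcard : Fintype.card K = p ^ m)
    (f : MvPolynomial σ K) (hf : f.totalDegree < Fintype.card σ) :
    (p : WittVector p K) ^ m ∣ ∑ x : σ → K, (∑ a ∈ f.support,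
      teichmuller p (f.coeff a) * ∏ j, teichmuller p (x j) ^ a j) ^ (p ^ m * (p ^ m - 1)) := by
  classical
  simp only [sum_pow_eq_sum_piAntidiag]
  rw [sum_comm]
  refine dvd_sum fun k hk => ?_
  have hksum : ∑ a ∈ f.support, k a = p ^ m * (p ^ m - 1) := (mem_piAntidiag.1 hk).1
  have hfactor : ∑ x : σ → K, (Nat.multinomial f.support k : WittVector p K) * ∏ a ∈ f.support,
        (teichmuller p (f.coeff a) * ∏ j, teichmuller p (x j) ^ a j) ^ k a =
      (Nat.multinomial f.support k : WittVector p K) *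
        (∏ a ∈ f.support, teichmuller p (f.coeff a) ^ k a) *
        ∏ j, ∑ y : K, teichmuller p y ^ ∑ a ∈ f.support, k a * a j := by
    rw [prod_univ_sum, Fintype.piFinset_univ, mul_sum]
    refine sum_congr rfl fun x _ => ?_
    simp only [mul_pow, prod_mul_distrib, ← prod_pow, ← pow_mul]
    rw [prod_comm, mul_assoc]
    simp only [prod_pow_eq_pow_sum, mul_comm (k _)]
  rw [hfactor]
  by_cases hzero : ∃ j, ∑ a ∈ f.support, k a * a j = 0
  · obtain ⟨j, hj⟩ := hzero
    refine (dvd_trans ?_ (dvd_prod_of_mem _ (mem_univ j))).mul_left _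
    simp [hj, hcard]
  by_cases hdiv : ∃ j, ¬ p ^ m - 1 ∣ ∑ a ∈ f.support, k a * a j
  · obtain ⟨j, hj⟩ := hdiv
    rw [← hcard] at hj
    rw [prod_eq_zero (mem_univ j) (sum_teichmuller_pow_eq_zero hj), mul_zero]
    exact dvd_zero _
  push Not at hzero hdiv
  have hp1 : 1 < p := hp.out.one_lt
  have hdig := Nat.two_mul_le_sum_sum_digits hp1 hm f.support (fun a j => a j)
    (fun a ha => by simpa [Finsupp.sum_fintype] using le_totalDegree ha) hf k
    (hksum ▸ Nat.dvd_mul_left _ _) hdiv fun j => Nat.pos_of_ne_zero (hzero j)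
  rw [← Nat.sub_one_mul_padicValNat_multinomial p, hksum, Nat.sum_digits_pow_mul hp1,
    Nat.sum_digits_pow_sub_one hp1] at hdig
  have hval : m ≤ padicValNat p (Nat.multinomial f.support k) := by
    refine Nat.le_of_mul_le_mul_left ?_ (Nat.sub_pos_of_lt hp1)
    rw [mul_comm (p - 1) m]
    omega
  rw [mul_assoc]
  refine Dvd.dvd.mul_right ?_ _
  exact_mod_cast Nat.cast_dvd_cast (α := WittVector p K)
    ((padicValNat_dvd_iff_le (Nat.multinomial_pos _ _).ne').2 hval)

end WittVector

/-- **Ax's theorem** for one polynomial: if its degree is less than the number of variables, the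
order of the field divides its number of zeros. -/
theorem MvPolynomial.card_dvd_card_zeros {K σ : Type*} [Field K] [Fintype K] [Fintype σ]
    (f : MvPolynomial σ K) (hf : f.totalDegree < Fintype.card σ) :
    Fintype.card K ∣ Nat.card {x : σ → K // eval x f = 0} := by
  classical
  obtain ⟨p, _⟩ := CharP.exists K
  obtain ⟨⟨m, hm⟩, hp, hcard⟩ := FiniteField.card K p
  simp only [PNat.mk_coe] at hcard
  have : Fact p.Prime := ⟨hp⟩
  have hq : 1 < p ^ m := hcard ▸ Fintype.one_lt_card
  have hind (x : σ → K) : (p : WittVector p K) ^ m ∣ (∑ a ∈ f.support,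
      WittVector.teichmuller p (f.coeff a) * ∏ j, WittVector.teichmuller p (x j) ^ a j) ^
        (p ^ m * (p ^ m - 1)) - if eval x f = 0 then 0 else 1 := by
    set F := ∑ a ∈ f.support,
      WittVector.teichmuller p (f.coeff a) * ∏ j, WittVector.teichmuller p (x j) ^ a j
    have hF : WittVector.constantCoeff F = eval x f := by
      have (y : K) : WittVector.constantCoeff (WittVector.teichmuller p y) = y :=
        WittVector.teichmuller_coeff_zero p y
      simp only [F, eval_eq', map_sum, map_mul, map_prod, map_pow, this]
    split_ifs with h
    · rw [sub_zero]
      refine (pow_dvd_pow_of_dvd ((WittVector.natCast_dvd_iff_constantCoeff F).2 (hF.trans h))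
        m).trans (pow_dvd_pow _ ?_)
      exact (Nat.lt_pow_self hp.one_lt).le.trans (Nat.le_mul_of_pos_right _ (by omega))
    · have h1 : (p : WittVector p K) ∣ F ^ (p ^ m - 1) - 1 := by
        rw [WittVector.natCast_dvd_iff_constantCoeff, map_sub, map_pow, hF, map_one, ← hcard,
          FiniteField.pow_card_sub_one_eq_one _ h, sub_self]
      have h2 := dvd_sub_pow_of_dvd_sub h1 m
      rw [one_pow, ← pow_mul, mul_comm] at h2
      exact (pow_dvd_pow _ m.le_succ).trans h2
  have hnonzero : p ^ m ∣ #{x : σ → K | ¬ eval x f = 0} := by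
    refine WittVector.natCast_pow_dvd_natCast (K := K) ?_
    have := dvd_sum fun x (_ : x ∈ univ) => hind x
    rw [sum_sub_distrib, dvd_sub_right (WittVector.pow_dvd_sum_lift_pow hm hcard f hf)] at this
    simpa [← sum_boole, ite_not] using this
  have htotal : p ^ m ∣ Fintype.card (σ → K) := by
    rw [Fintype.card_fun, hcard]
    exact dvd_pow_self _ (by omega)
  rw [hcard, Nat.card_eq_fintype_card, Fintype.card_subtype]
  refine (Nat.dvd_add_left hnonzero).1 ?_
  rwa [card_filter_add_card_filter_not, card_univ]


/-- Chevalley–Warning (affine cone form): if `K` is a finite field with `q` elements,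
`q` a power of the prime `p`, and `f` is a homogeneous polynomial of degree `d` in
`n + 1` variables with `1 ≤ d ≤ n`, then `q` divides the number of zeros of `f`
in `K^(n+1)`. -/
theorem chevalley_warning_affine_cone
    (p q n d : ℕ) (hp : p.Prime) (hq : ∃ m : ℕ, 0 < m ∧ q = p ^ m)
    (K : Type*) [Field K] [Fintype K] (hcard : Fintype.card K = q) [CharP K p]
    (f : MvPolynomial (Fin (n + 1)) K)
    (hf : f.IsHomogeneous d) (hd1 : 1 ≤ d) (hdn : d ≤ n) :
    q ∣ Nat.card {x : Fin (n + 1) → K // MvPolynomial.eval x f = 0} := by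
  subst hcard
  exact f.card_dvd_card_zeros <| by
    rw [Fintype.card_fin]
    exact hf.totalDegree_le.trans_lt (Nat.lt_succ_of_le hdn)
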